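/- For all real constants a, b, p, q, s, the metric g belongs to Gray's class ℬ: its Ricci tensor is a Codazzi tensor, i.e. ∇_i ρ_{jk} = ∇_j ρ_{ik} for all indices i,j,k at every point of ℝ⁴. -/

import Mathlib

noncomputable section

open scoped BigOperators

/-- The metric of a four-dimensional two-symmetric Lorentzian manifold, in
coordinates `x 0 = x¹, x 1 = x², x 2 = x³, x 3 = x⁴`:
`g₁₄ = g₄₁ = g₂₂ = g₃₃ = 1`,
`g₄₄ = x⁴(a(x²)² + b(x³)²) + p(x²)² + 2q x²x³ + s(x³)²`, all others zero. -/
def gmat (a b p q s : ℝ) (x : Fin 4 → ℝ) : Matrix (Fin 4) (Fin 4) ℝ :=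
  Matrix.of fun i j =>
    if i = 0 ∧ j = 3 then 1
    else if i = 3 ∧ j = 0 then 1
    else if i = 1 ∧ j = 1 then 1
    else if i = 2 ∧ j = 2 then 1
    else if i = 3 ∧ j = 3 then
      x 3 * (a * (x 1) ^ 2 + b * (x 2) ^ 2) + p * (x 1) ^ 2
        + 2 * q * x 1 * x 2 + s * (x 2) ^ 2
    else 0

/-- The inverse matrix `g^{ij}`. -/
def ginv (a b p q s : ℝ) (x : Fin 4 → ℝ) : Matrix (Fin 4) (Fin 4) ℝ :=
  (gmat a b p q s x)⁻¹

/-- Partial derivative `∂_i` of a function on ℝ⁴. -/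
def pd (i : Fin 4) (f : (Fin 4 → ℝ) → ℝ) (x : Fin 4 → ℝ) : ℝ :=
  fderiv ℝ f x (Pi.single i 1)

/-- Christoffel symbols `Γ^k_{ij} = (1/2) Σ_l g^{kl}(∂_i g_{jl} + ∂_j g_{il} − ∂_l g_{ij})`. -/
def Gam (a b p q s : ℝ) (k i j : Fin 4) (x : Fin 4 → ℝ) : ℝ :=
  (1 / 2) * ∑ l, ginv a b p q s x k l *
    (pd i (fun y => gmat a b p q s y j l) x
      + pd j (fun y => gmat a b p q s y i l) x
      - pd l (fun y => gmat a b p q s y i j) x)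

/-- Curvature tensor
`R^i_{jkl} = ∂_k Γ^i_{lj} − ∂_l Γ^i_{kj} + Σ_m (Γ^i_{km} Γ^m_{lj} − Γ^i_{lm} Γ^m_{kj})`. -/
def Riem (a b p q s : ℝ) (i j k l : Fin 4) (x : Fin 4 → ℝ) : ℝ :=
  pd k (Gam a b p q s i l j) x - pd l (Gam a b p q s i k j) x
    + ∑ m, (Gam a b p q s i k m x * Gam a b p q s m l j x
      - Gam a b p q s i l m x * Gam a b p q s m k j x)

/-- Ricci tensor `ρ_{jl} = Σ_i R^i_{jil}`. -/
def Ric (a b p q s : ℝ) (j l : Fin 4) (x : Fin 4 → ℝ) : ℝ :=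
  ∑ i, Riem a b p q s i j i l x

/-- Covariant derivative of the Ricci tensor
`∇_i ρ_{jk} = ∂_i ρ_{jk} − Σ_l (Γ^l_{ij} ρ_{lk} + Γ^l_{ik} ρ_{jl})`. -/
def covRic (a b p q s : ℝ) (i j k : Fin 4) (x : Fin 4 → ℝ) : ℝ :=
  pd i (Ric a b p q s j k) x
    - ∑ l, (Gam a b p q s l i j x * Ric a b p q s l k x
      + Gam a b p q s l i k x * Ric a b p q s j l x)

lemma ginv_eq (a b p q s : ℝ) (x : Fin 4 → ℝ) :
    ginv a b p q s x = !![-gmat a b p q s x 3 3, 0, 0, 1; 0, 1, 0, 0; 0, 0, 1, 0; 1, 0, 0, 0] := by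
  refine Matrix.inv_eq_right_inv ?_
  ext i j
  fin_cases i <;> fin_cases j <;> simp [gmat, Matrix.mul_apply, Fin.sum_univ_four] <;> ring

/-- The partial derivatives of `g₄₄`. -/
def gradPotential (a b p q s : ℝ) (l : Fin 4) (x : Fin 4 → ℝ) : ℝ :=
  ![0, 2 * a * x 3 * x 1 + 2 * p * x 1 + 2 * q * x 2,
    2 * b * x 3 * x 2 + 2 * q * x 1 + 2 * s * x 2, a * x 1 ^ 2 + b * x 2 ^ 2] l

lemma pd_const (i : Fin 4) (c : ℝ) (x : Fin 4 → ℝ) : pd i (fun _ => c) x = 0 := by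
  simp [pd]

lemma pd_coord (i j : Fin 4) (x : Fin 4 → ℝ) :
    pd i (fun y => y j) x = if j = i then 1 else 0 := by
  simp [pd, (hasFDerivAt_apply (𝕜 := ℝ) j x).fderiv, Pi.single_apply]

lemma pd_add (i : Fin 4) {f g : (Fin 4 → ℝ) → ℝ} {x : Fin 4 → ℝ}
    (hf : DifferentiableAt ℝ f x) (hg : DifferentiableAt ℝ g x) :
    pd i (fun y => f y + g y) x = pd i f x + pd i g x := by
  simp [pd, fderiv_fun_add hf hg]

lemma pd_mul (i : Fin 4) {f g : (Fin 4 → ℝ) → ℝ} {x : Fin 4 → ℝ}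
    (hf : DifferentiableAt ℝ f x) (hg : DifferentiableAt ℝ g x) :
    pd i (fun y => f y * g y) x = f x * pd i g x + g x * pd i f x := by
  simp [pd, fderiv_fun_mul hf hg]

lemma pd_gmat (a b p q s : ℝ) (l i j : Fin 4) (x : Fin 4 → ℝ) :
    pd l (fun y => gmat a b p q s y i j) x =
      if i = 3 ∧ j = 3 then gradPotential a b p q s l x else 0 := by
  by_cases h : i = 3 ∧ j = 3
  · obtain ⟨rfl, rfl⟩ := h
    simp (disch := fun_prop) [gmat, pow_two, pd_add, pd_mul, pd_const, pd_coord]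
    fin_cases l <;> simp [gradPotential] <;> ring
  · have hc : (fun y => gmat a b p q s y i j) = fun _ => gmat a b p q s 0 i j := by
      funext y
      simp [gmat, h]
    rw [hc, pd_const, if_neg h]

/-- Closed form of the Christoffel symbols. -/
lemma Gam_eq (a b p q s : ℝ) (k i j : Fin 4) :
    Gam a b p q s k i j = fun x =>
      if k = 0 then
        if i = 3 then 1 / 2 * gradPotential a b p q s j x
        else if j = 3 then 1 / 2 * gradPotential a b p q s i x else 0
      else if k = 3 then 0
      else if i = 3 ∧ j = 3 then -1 / 2 * gradPotential a b p q s k x else 0 := by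
  funext x
  simp only [Gam, ginv_eq, pd_gmat, Fin.sum_univ_four]
  fin_cases k <;> fin_cases i <;> fin_cases j <;> simp [gradPotential] <;> ring

lemma Ric_eq (a b p q s : ℝ) (j l : Fin 4) :
    Ric a b p q s j l = fun x =>
      if j = 3 ∧ l = 3 then -((a + b) * x 3 + (p + s)) else 0 := by
  funext x
  simp only [Ric, Riem, Gam_eq, Fin.sum_univ_four]
  fin_cases j <;> fin_cases l <;>
    simp (disch := fun_prop) [gradPotential, pow_two, pd_add, pd_mul, pd_const, pd_coord] <;>
    ring

lemma pd_Ric (a b p q s : ℝ) (i j k : Fin 4) (x : Fin 4 → ℝ) :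
    pd i (Ric a b p q s j k) x = if i = 3 ∧ j = 3 ∧ k = 3 then -(a + b) else 0 := by
  rw [Ric_eq]
  by_cases h : j = 3 ∧ k = 3
  · have hf : (fun x : Fin 4 → ℝ => if j = 3 ∧ k = 3 then -((a + b) * x 3 + (p + s)) else 0) =
        fun x => -(a + b) * x 3 + -(p + s) := by
      funext x
      rw [if_pos h]
      ring
    rw [hf, pd_add i (by fun_prop) (by fun_prop), pd_mul i (by fun_prop) (by fun_prop)]
    simp [pd_const, pd_coord, h, eq_comm]
  · simp [h, pd_const]

/-- for all real constants `a, b, p, q, s` the metric belongs to Gray's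
class ℬ: the Ricci tensor is a Codazzi tensor, `∇_i ρ_{jk} = ∇_j ρ_{ik}`. -/
theorem class_B (a b p q s : ℝ) (x : Fin 4 → ℝ) (i j k : Fin 4) :
    covRic a b p q s i j k x = covRic a b p q s j i k x := by
  simp only [covRic, pd_Ric]
  simp only [Ric_eq, Gam_eq, Fin.sum_univ_four]
  fin_cases i <;> fin_cases j <;> fin_cases k <;> simp [gradPotential]
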